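/- Corollary 1 (energy part, explicit form): Assume c_a ≥ 0 and c_Ω ≥ 0. Since ω₀ is a most frequent value of M, p₀ ≥ 2^{−H}, and using k̄ ≤ K − 1 and k̃ ≤ K − 1 one has E_CER/N ≤ (1 − 2^{−H})·c_a + ((K − 1)·(c_Ω + γ(b_I)) + γ(b_I) + δ(b_o))/n, and the same bound holds with E_CSER in place of E_CER; that is, the per-element dot-product cost of both representations is bounded by O(1 − 2^{−H}) + O(1/n) for fixed K and bit-sizes. -/

import Mathlib

open Finset
open scoped Classical

/-- The finite set of distinct values occurring in the matrix `M`. -/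
noncomputable def matVals {m n : ℕ} (M : Fin m → Fin n → ℝ) : Finset ℝ :=
  Finset.image (fun p : Fin m × Fin n => M p.1 p.2) Finset.univ

/-- The number of pairs `(i,j)` with `M i j = ω`. -/
noncomputable def cnt {m n : ℕ} (M : Fin m → Fin n → ℝ) (ω : ℝ) : ℕ :=
  (Finset.univ.filter (fun p : Fin m × Fin n => M p.1 p.2 = ω)).card

/-- The empirical probability mass `p(ω) = #(ω) / N` with `N = m·n`. -/
noncomputable def pmass {m n : ℕ} (M : Fin m → Fin n → ℝ) (ω : ℝ) : ℝ :=
  (cnt M ω : ℝ) / ((m : ℝ) * (n : ℝ))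

/-- `k̄_r`: the number of distinct values `ω ≠ ω₀` occurring in row `r` of `M`. -/
noncomputable def kbarRow {m n : ℕ} (M : Fin m → Fin n → ℝ) (ω₀ : ℝ) (r : Fin m) : ℕ :=
  ((Finset.image (M r) Finset.univ).erase ω₀).card

/-- `k̃_r`: the number of indices `k ∈ {1,…,K−1}` such that `ω_k = e k` does not occur in
row `r` of `M` but `e l` occurs in row `r` for some `l` with `k < l ≤ K−1`. -/
noncomputable def ktildeRow {m n K : ℕ} (M : Fin m → Fin n → ℝ) (e : Fin K → ℝ)
    (r : Fin m) : ℕ :=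
  (Finset.univ.filter (fun k : Fin K =>
    (k : ℕ) ≠ 0 ∧ (∀ j, M r j ≠ e k) ∧ ∃ l : Fin K, k < l ∧ ∃ j, M r j = e l)).card

theorem pmass_pos {m n : ℕ} (hm : 1 ≤ m) (hn : 1 ≤ n) (M : Fin m → Fin n → ℝ) {ω : ℝ}
    (hω : ω ∈ matVals M) : 0 < pmass M ω := by
  obtain ⟨p, -, hp⟩ := Finset.mem_image.mp hω
  have hcnt : 0 < cnt M ω :=
    Finset.card_pos.mpr ⟨p, Finset.mem_filter.mpr ⟨Finset.mem_univ _, hp⟩⟩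
  unfold pmass
  positivity

theorem sum_pmass {m n : ℕ} (hm : 1 ≤ m) (hn : 1 ≤ n) (M : Fin m → Fin n → ℝ) :
    ∑ ω ∈ matVals M, pmass M ω = 1 := by
  have hcard : ∑ ω ∈ matVals M, cnt M ω = m * n := by
    have h := Finset.card_eq_sum_card_fiberwise (s := (Finset.univ : Finset (Fin m × Fin n)))
      (t := matVals M) (f := fun p => M p.1 p.2)
      (fun p _ => Finset.mem_coe.mpr (Finset.mem_image_of_mem _ (Finset.mem_univ p)))
    rw [Finset.card_univ, Fintype.card_prod, Fintype.card_fin, Fintype.card_fin] at h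
    rw [h]
    rfl
  have hmn : (m : ℝ) * n ≠ 0 := by positivity
  unfold pmass
  rw [← Finset.sum_div, ← Nat.cast_sum, hcard, Nat.cast_mul, div_self hmn]

/-- The min-entropy of the value distribution is at most its Shannon entropy. -/
theorem two_rpow_sum_mul_logb_pmass_le {m n : ℕ} (hm : 1 ≤ m) (hn : 1 ≤ n)
    (M : Fin m → Fin n → ℝ) {ω₀ : ℝ} (hω₀ : ω₀ ∈ matVals M)
    (hmax : ∀ ω ∈ matVals M, pmass M ω ≤ pmass M ω₀) :
    (2 : ℝ) ^ (∑ ω ∈ matVals M, pmass M ω * Real.logb 2 (pmass M ω)) ≤ pmass M ω₀ := by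
  rw [← Real.le_logb_iff_rpow_le one_lt_two (pmass_pos hm hn M hω₀)]
  calc ∑ ω ∈ matVals M, pmass M ω * Real.logb 2 (pmass M ω)
      ≤ ∑ ω ∈ matVals M, pmass M ω * Real.logb 2 (pmass M ω₀) :=
        Finset.sum_le_sum fun ω hω =>
          mul_le_mul_of_nonneg_left
            (Real.logb_le_logb_of_le one_lt_two (pmass_pos hm hn M hω) (hmax ω hω))
            (pmass_pos hm hn M hω).le
    _ = Real.logb 2 (pmass M ω₀) := by rw [← Finset.sum_mul, sum_pmass hm hn, one_mul]

theorem kbarRow_add_one_le_card_matVals {m n : ℕ} (M : Fin m → Fin n → ℝ) {ω₀ : ℝ}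
    (hω₀ : ω₀ ∈ matVals M) (r : Fin m) : kbarRow M ω₀ r + 1 ≤ (matVals M).card := by
  rw [← Finset.card_erase_add_one hω₀, kbarRow]
  refine Nat.add_le_add_right (Finset.card_le_card (Finset.erase_subset_erase _ ?_)) 1
  intro x hx
  obtain ⟨j, -, rfl⟩ := Finset.mem_image.mp hx
  exact Finset.mem_image.mpr ⟨(r, j), Finset.mem_univ _, rfl⟩

theorem ktildeRow_add_one_le {m n K : ℕ} (hK : 0 < K) (M : Fin m → Fin n → ℝ)
    (e : Fin K → ℝ) (r : Fin m) : ktildeRow M e r + 1 ≤ K := by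
  have h : ktildeRow M e r < (Finset.univ : Finset (Fin K)).card := by
    refine Finset.card_lt_card (Finset.filter_ssubset.mpr ⟨⟨0, hK⟩, Finset.mem_univ _, ?_⟩)
    exact fun h => h.1 rfl
  rw [Finset.card_fin] at h
  exact h

theorem sum_natCast_le_mul_sub_one {m K : ℕ} {f : Fin m → ℕ} (hf : ∀ r, f r + 1 ≤ K) :
    ∑ r, (f r : ℝ) ≤ m * ((K : ℝ) - 1) := by
  have h : ∀ r ∈ (Finset.univ : Finset (Fin m)), (f r : ℝ) ≤ (K : ℝ) - 1 := fun r _ => by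
    have h' : (f r : ℝ) + 1 ≤ K := by exact_mod_cast hf r
    linarith
  simpa using Finset.sum_le_card_nsmul _ _ _ h

/-- A tally with `S` value loads and `T` further pointer loads, where `S, T ≤ m * k`, divided by
the number `m * n` of matrix entries. -/
theorem tally_div_le {m n S T k p q c_a c g d : ℝ} (hm : 0 < m) (hn : 0 < n)
    (hS : S ≤ m * k) (hT : T ≤ m * k) (hqp : q ≤ p) (hca : 0 ≤ c_a) (hc : 0 ≤ c) (hg : 0 ≤ g) :
    (S * c + T * g + m * g + m * d + m * n * (1 - p) * c_a) / (m * n)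
      ≤ (1 - q) * c_a + (k * (c + g) + g + d) / n := by
  have hsplit : (1 - q) * c_a + (k * (c + g) + g + d) / n
      = (m * k * c + m * k * g + m * g + m * d + m * n * (1 - q) * c_a) / (m * n) := by
    field_simp
    ring
  rw [hsplit]
  gcongr

/-- Corollary 1 (energy part, explicit form). -/
theorem cer_cser_energy_entropy_bound
    (m n : ℕ) (hm : 1 ≤ m) (hn : 1 ≤ n)
    (M : Fin m → Fin n → ℝ)
    (N : ℕ) (hN : N = m * n)
    (K : ℕ) (hK : K = (matVals M).card)
    (H : ℝ) (hH : H = -∑ ω ∈ matVals M, pmass M ω * Real.logb 2 (pmass M ω))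
    (ω₀ : ℝ) (hω₀ : ω₀ ∈ matVals M)
    (hmax : ∀ ω ∈ matVals M, pmass M ω ≤ pmass M ω₀)
    (p₀ : ℝ) (hp₀ : p₀ = pmass M ω₀)
    (e : Fin K → ℝ) (he_inj : Function.Injective e)
    (he_mem : ∀ k, e k ∈ matVals M)
    (hKpos : 0 < K) (he0 : e ⟨0, hKpos⟩ = ω₀)
    (he_mono : ∀ k l : Fin K, k ≤ l → pmass M (e l) ≤ pmass M (e k))
    (kbar : ℝ) (hkbar : kbar = (∑ r : Fin m, (kbarRow M ω₀ r : ℝ)) / (m : ℝ))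
    (ktilde : ℝ) (hktilde : ktilde = (∑ r : Fin m, (ktildeRow M e r : ℝ)) / (m : ℝ))
    (σ μ γ δ : ℕ → ℝ)
    (hσ : ∀ b, 0 ≤ σ b) (hμ : ∀ b, 0 ≤ μ b) (hγ : ∀ b, 0 ≤ γ b) (hδ : ∀ b, 0 ≤ δ b)
    (b_a b_Ω b_I b_o : ℕ)
    (c_a : ℝ) (hca : c_a = σ b_a + γ b_a + γ b_I) (hca_nonneg : 0 ≤ c_a)
    (c_Ω : ℝ) (hcΩ : c_Ω = γ b_I + γ b_Ω + μ b_o + σ b_o - σ b_a) (hcΩ_nonneg : 0 ≤ c_Ω)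
    (E_CER : ℝ)
    (hEcer : E_CER = (m : ℝ) * γ b_I
        + (∑ r : Fin m, ((kbarRow M ω₀ r : ℝ) + (ktildeRow M e r : ℝ))) * γ b_I
        + (∑ r : Fin m, (kbarRow M ω₀ r : ℝ)) * γ b_Ω
        + (N : ℝ) * (1 - p₀) * (γ b_I + γ b_a + σ b_a)
        + (∑ r : Fin m, (kbarRow M ω₀ r : ℝ)) * (μ b_o + σ b_o - σ b_a)
        + (m : ℝ) * δ b_o)
    (E_CSER : ℝ)
    (hEcser : E_CSER = (m : ℝ) * γ b_I
        + 2 * (∑ r : Fin m, (kbarRow M ω₀ r : ℝ)) * γ b_I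
        + (∑ r : Fin m, (kbarRow M ω₀ r : ℝ)) * γ b_Ω
        + (N : ℝ) * (1 - p₀) * (γ b_I + γ b_a + σ b_a)
        + (∑ r : Fin m, (kbarRow M ω₀ r : ℝ)) * (μ b_o + σ b_o - σ b_a)
        + (m : ℝ) * δ b_o) :
    (2 : ℝ) ^ (-H) ≤ p₀ ∧
    kbar ≤ (K : ℝ) - 1 ∧
    ktilde ≤ (K : ℝ) - 1 ∧
    E_CER / (N : ℝ) ≤ (1 - (2 : ℝ) ^ (-H)) * c_a
      + (((K : ℝ) - 1) * (c_Ω + γ b_I) + γ b_I + δ b_o) / (n : ℝ) ∧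
    E_CSER / (N : ℝ) ≤ (1 - (2 : ℝ) ^ (-H)) * c_a
      + (((K : ℝ) - 1) * (c_Ω + γ b_I) + γ b_I + δ b_o) / (n : ℝ) := by
  subst hN hH hp₀ hkbar hktilde hca hcΩ hEcer hEcser
  have hm' : (0 : ℝ) < m := by exact_mod_cast hm
  have hn' : (0 : ℝ) < n := by exact_mod_cast hn
  have hp : (2 : ℝ) ^ (-(-∑ ω ∈ matVals M, pmass M ω * Real.logb 2 (pmass M ω)))
      ≤ pmass M ω₀ := by
    rw [neg_neg]
    exact two_rpow_sum_mul_logb_pmass_le hm hn M hω₀ hmax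
  have hS : ∑ r, (kbarRow M ω₀ r : ℝ) ≤ m * ((K : ℝ) - 1) :=
    sum_natCast_le_mul_sub_one fun r => hK ▸ kbarRow_add_one_le_card_matVals M hω₀ r
  have hT : ∑ r, (ktildeRow M e r : ℝ) ≤ m * ((K : ℝ) - 1) :=
    sum_natCast_le_mul_sub_one fun r => ktildeRow_add_one_le hKpos M e r
  refine ⟨hp, (div_le_iff₀' hm').mpr hS, (div_le_iff₀' hm').mpr hT, ?_, ?_⟩
  · refine le_trans (le_of_eq ?_)
      (tally_div_le (d := δ b_o) hm' hn' hS hT hp hca_nonneg hcΩ_nonneg (hγ b_I))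
    rw [Finset.sum_add_distrib, Nat.cast_mul]
    ring
  · refine le_trans (le_of_eq ?_)
      (tally_div_le (d := δ b_o) hm' hn' hS hS hp hca_nonneg hcΩ_nonneg (hγ b_I))
    rw [Nat.cast_mul]
    ring
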